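/- arXiv:2211.08123 — 2 statements merged into one kernel-verified Lean document; each statement's English description precedes it below -/
import Mathlib

section
/- Let p be a prime and let G be an extraspecial p-group, i.e., a finite p-group whose center Z(G) has order p, whose commutator subgroup equals Z(G), and for which G/Z(G) is elementary abelian. Then ℂ[G] is of Knutson type: every irreducible complex character χ of G admits a virtual character φ with χ·φ = ρ_reg. -/
open scoped ComplexOrder

noncomputable section

/-- `χ : G → ℂ` is an irreducible character: the character of a simple
finite-dimensional complex representation of `G`. -/
def IsIrrChar (G : Type) [Group G] (χ : G → ℂ) : Prop :=
  ∃ V : FDRep ℂ G, CategoryTheory.Simple V ∧ χ = V.character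

/-- A virtual character is a `ℤ`-linear combination of irreducible characters. -/
def IsVirtualChar (G : Type) [Group G] (χ : G → ℂ) : Prop :=
  χ ∈ Submodule.span ℤ {f : G → ℂ | IsIrrChar G f}

open Classical in
/-- The regular character: `|G|` at the identity, `0` elsewhere. -/
def regChar (G : Type) [Group G] : G → ℂ :=
  fun g => if g = 1 then (Nat.card G : ℂ) else 0

/-- The Knutson index of `χ`: the least positive `n` such that `χ·φ = n·ρ_reg`
for some virtual character `φ`. -/
def KnutsonIndex (G : Type) [Group G] (χ : G → ℂ) : ℕ :=
  sInf {n : ℕ | 0 < n ∧ ∃ φ : G → ℂ, IsVirtualChar G φ ∧ χ * φ = n • regChar G}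

/-- `ℂ[G]` is of Knutson type: every irreducible character is regular invertible. -/
def IsKnutsonType (G : Type) [Group G] : Prop :=
  ∀ χ : G → ℂ, IsIrrChar G χ → ∃ φ : G → ℂ, IsVirtualChar G φ ∧ χ * φ = regChar G

/-- Savitskii's preorder: `φ ≤ χ` iff `φ(1) ≤ χ(1)` and every zero of `χ` is a zero of `φ`. -/
def SavitskiiLE (G : Type) [Group G] (φ χ : G → ℂ) : Prop :=
  φ 1 ≤ χ 1 ∧ ∀ g : G, χ g = 0 → φ g = 0

/-- A virtual character of positive degree is Savitskii-minimal if every virtual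
character of positive degree below it is also above it. -/
def SavitskiiMinimal (G : Type) [Group G] (χ : G → ℂ) : Prop :=
  ∀ φ : G → ℂ, IsVirtualChar G φ → 0 < φ 1 → SavitskiiLE G φ χ → SavitskiiLE G χ φ

end

section Characters

open scoped commutatorElement

variable {G : Type} [Group G]

theorem char_of_eq_add_of_isCompl {V : FDRep ℂ G} {σ τ : Subrepresentation (V.ρ)}
    (h : IsCompl σ τ) (g : G) :
    V.character g = (FDRep.of σ.toRepresentation).character g +
      (FDRep.of τ.toRepresentation).character g := by
  have hc : IsCompl σ.toSubmodule τ.toSubmodule := by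
    constructor
    · rw [disjoint_iff, ← Subrepresentation.toSubmodule_inf, h.inf_eq_bot]; rfl
    · rw [codisjoint_iff, ← Subrepresentation.toSubmodule_sup, h.sup_eq_top]; rfl
  have key : V.ρ g = (Submodule.prodEquivOfIsCompl _ _ hc).conj
      ((σ.toRepresentation g).prodMap (τ.toRepresentation g)) := by
    ext v
    obtain ⟨⟨x, y⟩, rfl⟩ := (Submodule.prodEquivOfIsCompl _ _ hc).surjective v
    simp [LinearEquiv.conj_apply, Subrepresentation.toRepresentation]
  simp only [FDRep.character, FDRep.of_ρ']
  rw [key, LinearMap.trace_conj', LinearMap.trace_prodMap']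

variable [Finite G]

theorem simple_of_isIrreducible {V : Type} [AddCommGroup V] [Module ℂ V] [FiniteDimensional ℂ V]
    (ρ : Representation ℂ G V) [ρ.IsIrreducible] : CategoryTheory.Simple (FDRep.of ρ) := by
  have := Fintype.ofFinite G
  have : Invertible (Nat.card G : ℂ) := invertibleOfNonzero (NeZero.ne _)
  rw [FDRep.simple_iff_char_is_norm_one]
  have h := Representation.char_orthonormal ρ ρ
  rw [if_pos ⟨.refl ρ⟩, inv_mul_eq_one₀ (NeZero.ne _)] at h
  exact h.symm

/-- Every character of a finite group is a virtual character. -/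
theorem isVirtualChar_character (V : FDRep ℂ G) : IsVirtualChar G V.character := by
  induction hn : Module.finrank ℂ V using Nat.strong_induction_on generalizing V with
  | _ n ih =>
  subst hn
  by_cases h0 : Subsingleton V
  · have : V.character = 0 := by
      ext g
      simp [FDRep.character, Subsingleton.elim (V.ρ g) 0]
    rw [this]
    exact Submodule.zero_mem _
  rw [not_subsingleton_iff_nontrivial] at h0
  by_cases hirr : Representation.IsIrreducible V.ρ
  · exact Submodule.subset_span ⟨FDRep.of V.ρ, simple_of_isIrreducible V.ρ, rfl⟩
  obtain ⟨σ, hb, ht⟩ : ∃ σ : Subrepresentation V.ρ, σ ≠ ⊥ ∧ σ ≠ ⊤ := by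
    by_contra! hcon
    have : Nontrivial (Subrepresentation V.ρ) := by
      refine ⟨⊥, ⊤, fun h => ?_⟩
      have := congrArg Subrepresentation.toSubmodule h
      exact bot_ne_top (α := Submodule ℂ V) this
    exact hirr ⟨fun σ => or_iff_not_imp_left.2 (hcon σ)⟩
  obtain ⟨τ, hc⟩ := exists_isCompl σ
  have lt (α : Subrepresentation V.ρ) (hα : α ≠ ⊤) :
      Module.finrank ℂ α.toSubmodule < Module.finrank ℂ V :=
    Submodule.finrank_lt fun h => hα (Subrepresentation.toSubmodule_injective h)
  have hτ : τ ≠ ⊤ := fun h => hb (by simpa [h] using hc.inf_eq_bot)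
  have hadd : V.character = (FDRep.of σ.toRepresentation).character +
      (FDRep.of τ.toRepresentation).character := funext (char_of_eq_add_of_isCompl hc)
  rw [hadd]
  exact Submodule.add_mem _ (ih _ (lt σ ht) _ rfl) (ih _ (lt τ hτ) _ rfl)

theorem character_leftRegular :
    (FDRep.of (Representation.leftRegular ℂ G)).character = regChar G := by
  classical
  have := Fintype.ofFinite G
  ext g
  rw [FDRep.character, FDRep.of_ρ', LinearMap.trace_eq_matrix_trace ℂ (MonoidAlgebra.basis G ℂ),
    Matrix.trace]
  have repr_apply (x : MonoidAlgebra ℂ G) (i : G) :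
      (MonoidAlgebra.basis G ℂ).repr x i = x.coeff i := rfl
  by_cases hg : g = 1 <;> simp [LinearMap.toMatrix_apply, repr_apply, regChar, hg]

theorem isVirtualChar_regChar : IsVirtualChar G (regChar G) :=
  character_leftRegular (G := G) ▸ isVirtualChar_character _

theorem isIrrChar_one : IsIrrChar G 1 := by
  have := Fintype.ofFinite G
  have hc : (FDRep.of (Representation.trivial ℂ G ℂ)).character = 1 := by
    ext g
    simp [FDRep.character, Representation.trivial]
  refine ⟨FDRep.of (Representation.trivial ℂ G ℂ), ?_, hc.symm⟩
  rw [FDRep.simple_iff_char_is_norm_one, hc]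
  simp [Nat.card_eq_fintype_card]

theorem exists_eq_smul_id_of_commute (V : FDRep ℂ G) [CategoryTheory.Simple V] (T : V →ₗ[ℂ] V)
    (hT : ∀ g, Commute (V.ρ g) T) : ∃ c : ℂ, T = c • LinearMap.id := by
  have h1 : Module.finrank ℂ (Representation.invariants (Representation.linHom V.ρ V.ρ)) = 1 := by
    rw [(Representation.linHom.invariantsEquivFDRepHom V V).finrank_eq]
    exact (FDRep.simple_iff_end_is_rank_one V).1 inferInstance
  have mem (f : V →ₗ[ℂ] V) (hf : ∀ g, Commute (V.ρ g) f) :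
      f ∈ Representation.invariants (Representation.linHom V.ρ V.ρ) := fun g => by
    rw [Representation.linHom_apply, ← Module.End.mul_eq_comp, ← Module.End.mul_eq_comp, ← mul_assoc,
      (hf g).eq, mul_assoc, ← map_mul, mul_inv_cancel, map_one, mul_one]
  by_cases h0 : (LinearMap.id : V →ₗ[ℂ] V) = 0
  · exact ⟨0, by rw [← LinearMap.comp_id T, h0, LinearMap.comp_zero, smul_zero]⟩
  obtain ⟨c, hc⟩ := (finrank_eq_one_iff_of_nonzero'
    (⟨LinearMap.id, mem _ fun g => Commute.one_right _⟩ :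
      Representation.invariants (Representation.linHom V.ρ V.ρ))
    (fun h => h0 (congrArg Subtype.val h))).1 h1 ⟨T, mem T hT⟩
  exact ⟨c, (congrArg Subtype.val hc).symm⟩

/-- An irreducible character occurs in an integral expression for the regular character
with coefficient equal to its degree. -/
theorem coeff_eq_of_linearCombination_eq_regChar (c : {f : G → ℂ | IsIrrChar G f} →₀ ℤ)
    (hc : Finsupp.linearCombination ℤ Subtype.val c = regChar G)
    (χ : {f : G → ℂ | IsIrrChar G f}) : (c χ : ℂ) = χ.1 1 := by
  classical
  have := Fintype.ofFinite G
  have : Invertible (Nat.card G : ℂ) := invertibleOfNonzero (NeZero.ne _)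
  have orth (ψ : {f : G → ℂ | IsIrrChar G f}) :
      (Nat.card G : ℂ)⁻¹ * ∑ g, ψ.1 g * χ.1 g⁻¹ = if ψ = χ then 1 else 0 := by
    obtain ⟨_, V, hV, rfl⟩ := ψ
    obtain ⟨_, W, hW, rfl⟩ := χ
    split_ifs with h
    · have h' : V.character = W.character := congrArg Subtype.val h
      have := FDRep.char_orthonormal V V
      rw [if_pos ⟨CategoryTheory.Iso.refl V⟩] at this
      simpa only [← h'] using this
    · rw [FDRep.char_orthonormal, if_neg]
      rintro ⟨i⟩
      exact h (Subtype.ext (FDRep.char_iso i))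
  have h1 : (Nat.card G : ℂ)⁻¹ * ∑ g, regChar G g * χ.1 g⁻¹ = χ.1 1 := by
    rw [Finset.sum_eq_single 1] <;> simp +contextual [regChar]
  rw [← h1, ← hc, Finsupp.linearCombination_apply, Finsupp.sum]
  simp only [Finset.sum_apply, Pi.smul_apply, Finset.sum_mul]
  rw [Finset.sum_comm, Finset.mul_sum]
  simp only [zsmul_eq_mul, mul_assoc, ← Finset.mul_sum, mul_left_comm _ (Int.cast _ : ℂ), orth]
  simp only [mul_ite, mul_one, mul_zero, Finset.sum_ite_eq', Finsupp.mem_support_iff]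
  split_ifs with h
  · rfl
  · rw [not_not.1 h, Int.cast_zero]

/-- In a group with center of prime order containing all commutators, an irreducible character
is either linear and trivial on the center, or it vanishes off the center and the
square of its degree is the index of the center. -/
theorem irr_dichotomy {p : ℕ} (hp : p.Prime) (hZ : Nat.card (Subgroup.center G) = p)
    (hcomm : commutator G ≤ Subgroup.center G) {χ : G → ℂ} (hχ : IsIrrChar G χ) :
    (∀ z ∈ Subgroup.center G, χ z = 1) ∨
      ((∀ g ∉ Subgroup.center G, χ g = 0) ∧ ∃ d : ℕ, χ 1 = d ∧ p * d ^ 2 = Nat.card G) := by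
  classical
  have := Fintype.ofFinite G
  obtain ⟨V, hV, rfl⟩ := hχ
  have hnorm := (FDRep.simple_iff_char_is_norm_one V).1 hV
  have scalar_norm (g : G) (hg : ∀ h, Commute (V.ρ h) (V.ρ g)) :
      V.character g * V.character g⁻¹ = (Module.finrank ℂ V : ℂ) ^ 2 := by
    obtain ⟨a, ha⟩ := exists_eq_smul_id_of_commute V _ hg
    have h1 : a * V.character g⁻¹ = Module.finrank ℂ V := by
      rw [FDRep.character, ← smul_eq_mul, ← map_smul, ← LinearMap.id_comp (V.ρ g⁻¹),
        ← LinearMap.smul_comp, ← ha, ← Module.End.mul_eq_comp, ← map_mul, mul_inv_cancel, map_one,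
        LinearMap.trace_one]
    have h2 : V.character g = a * Module.finrank ℂ V := by
      rw [FDRep.character, ha, map_smul, LinearMap.trace_id, smul_eq_mul]
    rw [h2, mul_right_comm, h1, sq]
  by_cases htriv : ∀ z ∈ Subgroup.center G, V.ρ z = 1
  · left
    have hall (g h : G) : Commute (V.ρ h) (V.ρ g) := by
      have h1 := htriv ⁅h, g⁆
        (hcomm (Subgroup.commutator_mem_commutator (Subgroup.mem_top h) (Subgroup.mem_top g)))
      have h2 : h * g = ⁅h, g⁆ * (g * h) := by group
      rw [commute_iff_eq, ← map_mul, ← map_mul, h2, map_mul, h1, one_mul]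
    have hd : (Module.finrank ℂ V : ℂ) ^ 2 = 1 := by
      rw [Finset.sum_congr rfl fun g _ => scalar_norm g (hall g), Finset.sum_const,
        Finset.card_univ, ← Nat.card_eq_fintype_card, nsmul_eq_mul] at hnorm
      exact mul_left_cancel₀ (NeZero.ne _) (hnorm.trans (mul_one _).symm)
    have hd1 : Module.finrank ℂ V = 1 := by
      have : Module.finrank ℂ V ^ 2 = 1 := by exact_mod_cast hd
      simpa using this
    intro z hz
    rw [FDRep.character, htriv z hz, LinearMap.trace_one, hd1, Nat.cast_one]
  · right
    have hvan : ∀ g ∉ Subgroup.center G, V.character g = 0 := by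
      intro g hg
      obtain ⟨h, hh⟩ : ∃ h, h * g ≠ g * h := by
        simpa [Subgroup.mem_center_iff] using hg
      have hz : ⁅h, g⁆ ∈ Subgroup.center G :=
        hcomm (Subgroup.commutator_mem_commutator (Subgroup.mem_top h) (Subgroup.mem_top g))
      obtain ⟨a, ha⟩ := exists_eq_smul_id_of_commute V (V.ρ ⁅h, g⁆) (fun x => by
        rw [commute_iff_eq, ← map_mul, ← map_mul, Subgroup.mem_center_iff.1 hz])
      have ha1 : a ≠ 1 := by
        rintro rfl
        rw [one_smul] at ha
        refine htriv fun z hz' => ?_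
        have hp' := Fact.mk hp
        have hne : (⟨⁅h, g⁆, hz⟩ : Subgroup.center G) ≠ 1 := fun h1 =>
          hh (commutatorElement_eq_one_iff_mul_comm.1 (congrArg Subtype.val h1))
        obtain ⟨n, hn⟩ := mem_zpowers_of_prime_card hZ (g' := ⟨z, hz'⟩) hne
        have hn' : ⁅h, g⁆ ^ n = z := congrArg Subtype.val hn
        have hker : ⁅h, g⁆ ∈ V.ρ.ker := ha
        exact hn' ▸ zpow_mem hker n
      have h1 : V.character g = a * V.character g := by
        conv_lhs => rw [← V.char_conj g h]
        have : h * g * h⁻¹ = ⁅h, g⁆ * g := by simp [commutatorElement_def]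
        rw [this, FDRep.character, map_mul, ha]
        rw [← Module.End.one_eq_id, smul_mul_assoc, one_mul, map_smul, smul_eq_mul,
          FDRep.character]
      by_contra h0
      exact ha1 (mul_right_cancel₀ h0 (by rw [← h1, one_mul]))
    refine ⟨hvan, Module.finrank ℂ V, V.char_one, ?_⟩
    have : ∑ g : G, V.character g * V.character g⁻¹ =
        ∑ g ∈ Finset.univ.filter (· ∈ Subgroup.center G), (Module.finrank ℂ V : ℂ) ^ 2 := by
      rw [Finset.sum_filter]
      refine Finset.sum_congr rfl fun g _ => ?_
      split_ifs with hg
      · exact scalar_norm g fun x => by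
          rw [commute_iff_eq, ← map_mul, ← map_mul, Subgroup.mem_center_iff.1 hg]
      · rw [hvan g hg, zero_mul]
    rw [this, Finset.sum_const, ← Fintype.card_subtype, nsmul_eq_mul] at hnorm
    rw [Nat.card_eq_fintype_card] at hZ
    have e : Fintype.card {x // x ∈ Subgroup.center G} = p := by rw [← hZ]
    rw [e] at hnorm
    exact_mod_cast hnorm

end Characters

/-- Every extraspecial `p`-group is of Knutson type: `G` is a finite
`p`-group with center of order `p`, commutator subgroup equal to the center, and
elementary abelian central quotient. -/
theorem extraspecial_isKnutsonType (p : ℕ) (hp : p.Prime) (G : Type) [Group G] [Finite G]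
    (hpg : IsPGroup p G)
    (hZ : Nat.card (Subgroup.center G) = p)
    (hcomm : commutator G = Subgroup.center G)
    (helem : ∀ x : G ⧸ Subgroup.center G, x ^ p = 1) :
    IsKnutsonType G := by
  classical
  intro χ hχ
  obtain ⟨c, hc⟩ := (Finsupp.mem_span_iff_linearCombination ℤ _ _).1 (isVirtualChar_regChar (G := G))
  rcases irr_dichotomy hp hZ hcomm.le hχ with hlin | ⟨hvan, d, hd, hdG⟩
  · refine ⟨regChar G, isVirtualChar_regChar, ?_⟩
    ext g
    by_cases hg : g = 1
    · simp [hg, hlin 1 (one_mem _)]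
    · simp [regChar, hg]
  have hd0 : (d : ℂ) ≠ 0 := by
    rintro h
    have : d = 0 := by exact_mod_cast h
    simp [this] at hdG
    exact Nat.card_pos.ne hdG
  let linear (ψ : {f : G → ℂ | IsIrrChar G f}) : Prop := ∀ z ∈ Subgroup.center G, ψ.1 z = 1
  let S : G → ℂ := ∑ ψ ∈ c.support.filter (fun ψ => ¬ linear ψ), ψ.1
  have hdeg (ψ : {f : G → ℂ | IsIrrChar G f}) (hψ : ¬ linear ψ) : ψ.1 1 = d := by
    obtain ⟨-, e, he, heG⟩ := (irr_dichotomy hp hZ hcomm.le ψ.2).resolve_left hψ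
    rw [he]
    have := Nat.eq_of_mul_eq_mul_left hp.pos (heG.trans hdG.symm)
    exact_mod_cast Nat.pow_left_injective two_ne_zero this
  let L : ℤ := ∑ ψ ∈ c.support.filter linear, c ψ
  have hreg (z : G) (hz : z ∈ Subgroup.center G) : regChar G z = L + d * S z := by
    rw [← hc, Finsupp.linearCombination_apply, Finsupp.sum,
      ← Finset.sum_filter_add_sum_filter_not c.support linear]
    simp only [Pi.add_apply, Finset.sum_apply, Pi.mul_apply, Pi.intCast_apply, zsmul_eq_mul, L, S,
      Finset.mul_sum, Int.cast_sum]
    congr 1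
    · refine Finset.sum_congr rfl fun ψ hψ => ?_
      rw [(Finset.mem_filter.1 hψ).2 z hz, mul_one]
    · refine Finset.sum_congr rfl fun ψ hψ => ?_
      rw [coeff_eq_of_linearCombination_eq_regChar c hc, hdeg ψ (Finset.mem_filter.1 hψ).2]
  let N := (c.support.filter (fun ψ => ¬ linear ψ)).card
  have hS1 : S 1 = N * d := by
    simp only [S, Finset.sum_apply]
    rw [Finset.sum_congr rfl fun ψ hψ => hdeg ψ (Finset.mem_filter.1 hψ).2]
    simp [N]
  let m : ℤ := p * d - N * d
  have hL : (L : ℂ) = d * m := by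
    have h := hreg 1 (one_mem _)
    rw [hS1] at h
    simp only [regChar, if_true, ← hdG] at h
    push_cast [m] at h ⊢
    linear_combination -h
  refine ⟨S + m • 1, ?_, ?_⟩
  · exact Submodule.add_mem _ (Submodule.sum_mem _ fun ψ _ => Submodule.subset_span ψ.2)
      (Submodule.smul_mem _ _ (Submodule.subset_span isIrrChar_one))
  ext g
  by_cases hg : g ∈ Subgroup.center G
  · have h := hreg g hg
    rw [hL] at h
    simp only [Pi.mul_apply, Pi.add_apply, Pi.intCast_apply, zsmul_eq_mul, mul_one]
    by_cases h1 : g = 1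
    · subst h1
      rw [hd, h]
      ring
    · simp only [regChar, if_neg h1] at h ⊢
      have : S g + m = 0 := (mul_eq_zero.1 (show (d : ℂ) * (S g + m) = 0 by
        rw [h]; ring)).resolve_left hd0
      rw [this, mul_zero]
  · have h1 : g ≠ 1 := fun h => hg (h ▸ one_mem _)
    simp [hvan g hg, regChar, h1]
end

section
/- Let G be a finite group, χ an irreducible complex character of G, and p a prime. If the p-adic valuation of χ(1) equals the p-adic valuation of |G| (i.e., the highest power of p dividing χ(1) is also the highest power of p dividing |G|), then p does not divide the Knutson index K(χ). -/
open scoped ComplexOrder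

theorem Matrix.trace_eq_of_isIdempotentElem_of_map_residue_eq {R n : Type*} [CommRing R]
    [IsLocalRing R] [Fintype n] [DecidableEq n] {E F : Matrix n n R}
    (hE : IsIdempotentElem E) (hF : IsIdempotentElem F)
    (h : E.map (IsLocalRing.residue R) = F.map (IsLocalRing.residue R)) :
    E.trace = F.trace := by
  set U := E * F + (1 - E) * (1 - F) with hU
  have hUmap : (IsLocalRing.residue R).mapMatrix U = 1 := by
    have hE' : (IsLocalRing.residue R).mapMatrix E * (IsLocalRing.residue R).mapMatrix E =
        (IsLocalRing.residue R).mapMatrix E := by rw [← map_mul, hE.eq]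
    have h' : (IsLocalRing.residue R).mapMatrix F = (IsLocalRing.residue R).mapMatrix E := h.symm
    simp only [hU, map_add, map_mul, map_sub, map_one, h', mul_sub, sub_mul, one_mul, mul_one, hE']
    abel
  have hdet : IsUnit U.det := by
    refine (isUnit_map_iff (IsLocalRing.residue R) _).1 ?_
    rw [RingHom.map_det, hUmap, Matrix.det_one]
    exact isUnit_one
  have hEU : E * U = U * F := by
    simp only [hU, mul_add, add_mul, mul_sub, sub_mul, mul_one, one_mul, mul_assoc, hF.eq]
    simp only [← mul_assoc, hE.eq]
    abel
  calc E.trace = (E * U * U⁻¹).trace := by rw [Matrix.mul_nonsing_inv_cancel_right _ _ hdet]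
    _ = F.trace := by
      rw [hEU, mul_assoc, Matrix.trace_mul_comm, Matrix.nonsing_inv_mul_cancel_right _ _ hdet]

theorem isIdempotentElem_sum_pow_mul {S : Type*} [Ring S] (u : Sˣ) (v : S) (q : ℕ)
    (hu : u ^ q = 1)
    (hv : ∑ i ∈ Finset.range q, ((u ^ i : Sˣ) : S) * v * ((u ^ i)⁻¹ : Sˣ) = 1) :
    IsIdempotentElem ((∑ i ∈ Finset.range q, (u : S) ^ i) * v) := by
  set N := ∑ i ∈ Finset.range q, (u : S) ^ i
  have hN : (u : S) * N = N := by
    have h := mul_geom_sum (u : S) q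
    rwa [← Units.val_pow_eq_pow_val, hu, Units.val_one, sub_self, sub_mul, one_mul,
      sub_eq_zero] at h
  have hpow (i : ℕ) : ((u ^ i : Sˣ) : S) * N = N := by
    induction i with
    | zero => simp
    | succ i ih => rw [pow_succ, Units.val_mul, mul_assoc, hN, ih]
  have hinv (i : ℕ) : (((u ^ i)⁻¹ : Sˣ) : S) * N = N := by
    rw [Units.inv_mul_eq_iff_eq_mul, hpow]
  calc N * v * (N * v) = ∑ i ∈ Finset.range q, (u : S) ^ i * v * (N * v) := by
        rw [← Finset.sum_mul, ← Finset.sum_mul]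
    _ = ∑ i ∈ Finset.range q, ((u ^ i : Sˣ) : S) * v * ((u ^ i)⁻¹ : Sˣ) * (N * v) := by
        refine Finset.sum_congr rfl fun i _ => ?_
        rw [mul_assoc (_ * v) _ (N * v), ← mul_assoc (((u ^ i)⁻¹ : Sˣ) : S) N v, hinv,
          Units.val_pow_eq_pow_val]
    _ = N * v := by rw [← Finset.sum_mul, hv, one_mul]

theorem isIdempotentElem_sum_smul_pow_mul {R S : Type*} [CommRing R] [Ring S] [Algebra R S]
    (l : Rˣ) (g : Sˣ) (v : S) (q : ℕ) (hl : l ^ q = 1) (hg : g ^ q = 1)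
    (hv : ∑ i ∈ Finset.range q, ((g ^ i : Sˣ) : S) * v * ((g ^ i)⁻¹ : Sˣ) = 1) :
    IsIdempotentElem ((∑ i ∈ Finset.range q, ((l : R) • (g : S)) ^ i) * v) := by
  let s : Sˣ := Units.map (algebraMap R S).toMonoidHom l
  have hs : Commute s g := Units.ext (Algebra.commutes (l : R) (g : S))
  have hsg : ((s * g : Sˣ) : S) = (l : R) • (g : S) := (Algebra.smul_def _ _).symm
  have hsi (i : ℕ) : ((s ^ i : Sˣ) : S) = algebraMap R S ((l : R) ^ i) := by
    rw [Units.val_pow_eq_pow_val, map_pow]; rfl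
  rw [← hsg]
  refine isIdempotentElem_sum_pow_mul (s * g) v q
    (by rw [hs.mul_pow, hg, mul_one, ← map_pow, hl, map_one]) ?_
  rw [← hv]
  refine Finset.sum_congr rfl fun i _ => ?_
  calc (((s * g) ^ i : Sˣ) : S) * v * (((s * g) ^ i)⁻¹ : Sˣ)
      = ((s ^ i : Sˣ) : S) * (((g ^ i : Sˣ) : S) * v * ((g ^ i)⁻¹ : Sˣ)) *
          ((s ^ i)⁻¹ : Sˣ) := by
        rw [hs.mul_pow, mul_inv_rev, Units.val_mul, Units.val_mul]
        simp only [mul_assoc]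
    _ = ((g ^ i : Sˣ) : S) * v * ((g ^ i)⁻¹ : Sˣ) := by
        rw [hsi, Algebra.commutes, ← hsi, mul_assoc, Units.mul_inv, mul_one]

theorem IsLocalRing.residue_eq_one_of_pow_char_pow_eq_one {R : Type*} [CommRing R] [IsLocalRing R]
    (p k : ℕ) [Fact p.Prime] [CharP (IsLocalRing.ResidueField R) p] {x : R}
    (hx : x ^ p ^ k = 1) : IsLocalRing.residue R x = 1 := by
  have h : (IsLocalRing.residue R x - 1) ^ p ^ k = 0 := by
    rw [sub_pow_char_pow, ← map_pow, hx, map_one, one_pow, sub_self]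
  exact sub_eq_zero.1 (eq_zero_of_pow_eq_zero h)

theorem Matrix.trace_eq_zero_of_sum_conj_eq_one {R n : Type*} [CommRing R] [IsDomain R]
    [IsLocalRing R] [Fintype n] [DecidableEq n] (p k : ℕ) [Fact p.Prime]
    [CharP (IsLocalRing.ResidueField R) p] (hk : k ≠ 0) {ζ : R} (hζ : IsPrimitiveRoot ζ (p ^ k))
    (g : (Matrix n n R)ˣ) (hg : g ^ p ^ k = 1) (v : Matrix n n R)
    (hv : ∑ i ∈ Finset.range (p ^ k),
      ((g ^ i : (Matrix n n R)ˣ) : Matrix n n R) * v * ((g ^ i)⁻¹ : (Matrix n n R)ˣ) = 1) :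
    (g : Matrix n n R).trace = 0 := by
  set q := p ^ k with hq
  have hq1 : 1 < q := Nat.one_lt_pow hk (Fact.out : p.Prime).one_lt
  let t (i : ℕ) : R := ((g : Matrix n n R) ^ i * v).trace
  let E (l : R) : Matrix n n R := (∑ i ∈ Finset.range q, (l • (g : Matrix n n R)) ^ i) * v
  have htrE (l : R) : (E l).trace = ∑ i ∈ Finset.range q, l ^ i * t i := by
    simp [E, t, Finset.sum_mul, Matrix.trace_sum, smul_pow, Matrix.trace_smul]
  have hid (l : Rˣ) (hl : l ^ q = 1) : IsIdempotentElem (E (l : R)) := by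
    exact isIdempotentElem_sum_smul_pow_mul l g v q hl hg hv
  have hconst (l : Rˣ) (hl : l ^ q = 1) : (E (l : R)).trace = (E 1).trace := by
    refine Matrix.trace_eq_of_isIdempotentElem_of_map_residue_eq (hid l hl)
      (by simpa using hid 1 (one_pow q)) ?_
    have hl' : (l : R) ^ p ^ k = 1 := by rw [← Units.val_pow_eq_pow_val, ← hq, hl, Units.val_one]
    have hres := IsLocalRing.residue_eq_one_of_pow_char_pow_eq_one p k hl'
    change (IsLocalRing.residue R).mapMatrix _ = (IsLocalRing.residue R).mapMatrix _
    have hsm : (IsLocalRing.residue R).mapMatrix ((l : R) • (g : Matrix n n R)) =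
        (IsLocalRing.residue R).mapMatrix (g : Matrix n n R) := by
      ext i j
      simp [hres]
    simp only [E, map_mul, map_sum, map_pow, hsm, one_smul]
  have hgeom (m : ℕ) (hm : ¬ q ∣ m) : ∑ j ∈ Finset.range q, (ζ ^ m) ^ j = 0 := by
    have h := mul_geom_sum (ζ ^ m) q
    rw [← pow_mul, mul_comm m, pow_mul, hζ.pow_eq_one, one_pow, sub_self] at h
    exact (mul_eq_zero.1 h).resolve_left
      (sub_ne_zero.2 fun h1 => hm (hζ.pow_eq_one_iff_dvd m |>.1 h1))
  have hζu : ζ ^ q = 1 := hζ.pow_eq_one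
  have hj (j : ℕ) : ∑ i ∈ Finset.range q, (ζ ^ j) ^ i * t i = (E 1).trace := by
    rw [← htrE]
    let l : Rˣ := Units.ofPowEqOne (ζ ^ j) q
      (by rw [← pow_mul, mul_comm, pow_mul, hζu, one_pow]) (by omega)
    have hl : (l : R) = ζ ^ j := rfl
    rw [← hl]
    refine hconst l (Units.ext ?_)
    rw [Units.val_pow_eq_pow_val, hl, ← pow_mul, mul_comm, pow_mul, hζu, one_pow, Units.val_one]
  have hmain : (q : R) * t 1 = 0 := by
    have h1 : ∑ j ∈ Finset.range q, (ζ ^ (q - 1)) ^ j *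
        ∑ i ∈ Finset.range q, (ζ ^ j) ^ i * t i = 0 := by
      simp only [hj]
      rw [← Finset.sum_mul, hgeom _ (Nat.not_dvd_of_pos_of_lt (by omega) (by omega)), zero_mul]
    rw [← h1]
    simp only [Finset.mul_sum]
    rw [Finset.sum_comm]
    have h2 (i : ℕ) : ∑ j ∈ Finset.range q, (ζ ^ (q - 1)) ^ j * ((ζ ^ j) ^ i * t i) =
        (∑ j ∈ Finset.range q, (ζ ^ (q - 1 + i)) ^ j) * t i := by
      rw [Finset.sum_mul]
      refine Finset.sum_congr rfl fun j _ => ?_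
      ring
    simp only [h2]
    rw [Finset.sum_eq_single 1]
    · rw [Nat.sub_add_cancel hq1.le, hζu]
      simp
    · intro i hi hi1
      rw [hgeom, zero_mul]
      rintro ⟨c, hc⟩
      rw [Finset.mem_range] at hi
      obtain rfl | rfl | hc2 : c = 0 ∨ c = 1 ∨ 2 ≤ c := by omega
      · omega
      · omega
      · have := Nat.mul_le_mul_left q hc2
        omega
    · simp [hq1]
  calc (g : Matrix n n R).trace = ((∑ i ∈ Finset.range q, ((g ^ i : (Matrix n n R)ˣ) :
        Matrix n n R) * v * ((g ^ i)⁻¹ : (Matrix n n R)ˣ)) * (g : Matrix n n R)).trace := by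
        rw [hv, one_mul]
    _ = ∑ i ∈ Finset.range q, t 1 := by
        rw [Finset.sum_mul, Matrix.trace_sum]
        refine Finset.sum_congr rfl fun i _ => ?_
        rw [mul_assoc, Matrix.trace_mul_comm, ← mul_assoc, ← Units.val_mul, ← Units.val_mul,
          show (g ^ i)⁻¹ * g * g ^ i = g by group]
        simp [t]
    _ = 0 := by simpa using hmain

theorem Representation.finrank_smul_sum_conj {k G V : Type*} [Field k] [IsAlgClosed k] [Group G]
    [Fintype G] [AddCommGroup V] [Module k V] [FiniteDimensional k V] (ρ : Representation k G V)
    [ρ.IsIrreducible] (f : Module.End k V) :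
    (Module.finrank k V : k) • ∑ g, ρ g * f * ρ g⁻¹ =
      ((Fintype.card G : k) * LinearMap.trace k V f) • 1 := by
  set T : Module.End k V := ∑ g, ρ g * f * ρ g⁻¹ with hT
  have hcomm (h : G) : T * ρ h = ρ h * T := by
    rw [hT, Finset.sum_mul, Finset.mul_sum]
    refine Fintype.sum_equiv (Equiv.mulLeft h⁻¹) _ _ fun g => ?_
    simp only [Equiv.coe_mulLeft, mul_inv_rev, inv_inv, mul_assoc, ← map_mul]
    rw [← mul_assoc (ρ h), ← map_mul, mul_inv_cancel_left]
  obtain ⟨c, hc⟩ := (Representation.IsIrreducible.algebraMap_intertwiningMap_bijective_of_isAlgClosed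
    (ρ := ρ)).surjective ⟨T, hcomm⟩
  have hTc : T = c • 1 := by
    have := congrArg Representation.IntertwiningMap.toLinearMap hc
    ext v
    exact (congrArg (fun F : V →ₗ[k] V => F v) this).symm
  have htr : LinearMap.trace k V T = (Fintype.card G : k) * LinearMap.trace k V f := by
    have h (g : G) : LinearMap.trace k V (ρ g * f * ρ g⁻¹) = LinearMap.trace k V f := by
      rw [LinearMap.trace_mul_comm, ← mul_assoc, ← map_mul, inv_mul_cancel, map_one, one_mul]
    simp [hT, h]
  rw [← htr, hTc, smul_smul]
  simp [mul_comm]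

/-- A representation of a finite group over the field of fractions of a valuation ring can be
defined over that ring. -/
theorem Representation.exists_matrix_valuationRing {R K G V : Type*} [CommRing R] [IsDomain R]
    [ValuationRing R] [Field K] [Algebra R K] [IsFractionRing R K] [Group G] [Finite G]
    [AddCommGroup V] [Module K V] [FiniteDimensional K V] (ρ : Representation K G V) :
    ∃ (n : ℕ) (B : Module.Basis (Fin n) K V) (A : G →* Matrix (Fin n) (Fin n) R),
      ∀ g, (A g).map (algebraMap R K) = LinearMap.toMatrixAlgEquiv B (ρ g) := by
  let _ : Module R V := Module.compHom V (algebraMap R K)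
  have : IsScalarTower R K V := ⟨fun r a v => by
    rw [Algebra.smul_def, mul_smul]; rfl⟩
  let B₀ := Module.finBasis K V
  let s : Set V := Set.range fun x : G × Fin (Module.finrank K V) => ρ x.1 (B₀ x.2)
  let M : Submodule R V := Submodule.span R s
  have hs (i) : B₀ i ∈ s := ⟨(1, i), by simp⟩
  have : Submodule.IsLattice K M :=
    { fg := Submodule.fg_span (Set.finite_range _)
      span_eq_top := by
        rw [eq_top_iff, ← B₀.span_eq]
        refine Submodule.span_mono ?_
        rintro _ ⟨i, rfl⟩
        exact Submodule.subset_span (hs i) }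
  have : Module.IsTorsionFree R V := Module.IsTorsionFree.trans_faithfulSMul R K V
  have : Module.Flat R M := by
    rw [Module.Flat.flat_iff_torsion_eq_bot_of_isBezout, ← Submodule.isTorsionFree_iff_torsion_eq_bot]
    infer_instance
  have : Module.Free R M := Module.free_of_flat_of_isLocalRing
  let b := Module.finBasis R M
  have hM (g : G) : ∀ v ∈ M, (ρ g).restrictScalars R v ∈ M := by
    intro v hv
    induction hv using Submodule.span_induction with
    | mem v hv =>
      obtain ⟨⟨h, i⟩, rfl⟩ := hv
      refine Submodule.subset_span ⟨(g * h, i), ?_⟩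
      simp
    | zero => simp
    | add v w _ _ hv hw => rw [map_add]; exact add_mem hv hw
    | smul r v _ hv => rw [map_smul]; exact M.smul_mem r hv
  let σ : G →* Module.End R M :=
    { toFun g := ((ρ g).restrictScalars R).restrict (hM g)
      map_one' := by ext; simp
      map_mul' g h := by ext; simp }
  refine ⟨_, b.extendOfIsLattice K,
    (LinearMap.toMatrixAlgEquiv b).toAlgHom.toMonoidHom.comp σ, fun g => ?_⟩
  ext i j
  have h1 : ρ g (b.extendOfIsLattice K j) = ∑ l, algebraMap R K (b.repr (σ g (b j)) l) •
      b.extendOfIsLattice K l := by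
    have h2 := congrArg (Subtype.val) (b.sum_repr (σ g (b j)))
    simp only [Module.Basis.extendOfIsLattice_apply, algebraMap_smul]
    rw [Submodule.coe_sum] at h2
    exact h2.symm
  rw [LinearMap.toMatrixAlgEquiv_apply, h1, Module.Basis.repr_sum_self]
  simp [LinearMap.toMatrixAlgEquiv_apply]

/-- A sum of conjugates over a finite group is a sum of conjugates over the powers of any given
element. -/
theorem MonoidHom.exists_sum_range_conj_eq_sum_conj {G S : Type*} [Group G] [Fintype G] [Ring S]
    (A : G →* S) (g : G) (v : S) :
    ∃ w : S, ∑ i ∈ Finset.range (orderOf g), A (g ^ i) * w * A (g ^ i)⁻¹ =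
      ∑ x, A x * v * A x⁻¹ := by
  classical
  let H := Subgroup.zpowers g
  obtain ⟨T, hT, -⟩ := H.exists_isComplement_right 1
  refine ⟨∑ t : T, A t * v * A (t : G)⁻¹, ?_⟩
  have hH (F : G → S) : ∑ i ∈ Finset.range (orderOf g), F (g ^ i) = ∑ h : H, F h := by
    rw [← Fin.sum_univ_eq_sum_range (fun i => F (g ^ i))]
    refine Fintype.sum_equiv (finEquivZPowers (isOfFinOrder_of_finite g)) _ _ fun i => ?_
    rw [finEquivZPowers_apply]
  rw [hH fun x => A x * _ * A x⁻¹, ← (Equiv.ofBijective _ hT).sum_comp, Fintype.sum_prod_type]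
  refine Finset.sum_congr rfl fun h _ => ?_
  rw [Finset.mul_sum, Finset.sum_mul]
  refine Finset.sum_congr rfl fun t _ => ?_
  simp [mul_assoc]

theorem exists_valuationSubring_charP_residueField (K : Type*) [Field K] [CharZero K] (p : ℕ)
    (hp : p.Prime) : ∃ R : ValuationSubring K, CharP (IsLocalRing.ResidueField R) p := by
  let I : Ideal (⊥ : Subring K) := Ideal.span {(p : (⊥ : Subring K))}
  have hI : I ≠ ⊤ := by
    rw [Ne, Ideal.span_singleton_eq_top, isUnit_iff_exists_inv]
    rintro ⟨⟨y, hy⟩, h⟩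
    obtain ⟨n, rfl⟩ := Subring.mem_bot.1 hy
    have h' : (p : K) * (n : K) = 1 := congrArg Subtype.val h
    have h'' : (p : ℤ) * n = 1 := by exact_mod_cast h'
    exact hp.one_lt.ne' (Int.natAbs_of_isUnit (IsUnit.of_mul_eq_one _ h''))
  obtain ⟨R, -, hR⟩ := Ideal.image_subset_nonunits_valuationSubring I hI
  refine ⟨R, (CharP.charP_iff_prime_eq_zero hp).2 ?_⟩
  have hpR : (p : K) ∈ R.nonunits := hR ⟨p, Ideal.mem_span_singleton_self _, rfl⟩
  rw [← map_natCast (IsLocalRing.residue R), IsLocalRing.residue_eq_zero_iff]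
  obtain ⟨h, hm⟩ := ValuationSubring.mem_nonunits_iff_exists_mem_maximalIdeal.1 hpR
  exact hm

/-- An irreducible character whose degree is divisible by the full power of `p` dividing the
group order vanishes on the nontrivial elements of `p`-power order. -/
theorem Representation.trace_eq_zero_of_orderOf_eq_prime_pow {K G V : Type*} [Field K] [CharZero K]
    [IsAlgClosed K] [Group G] [Finite G] [AddCommGroup V] [Module K V] [FiniteDimensional K V]
    (ρ : Representation K G V) [ρ.IsIrreducible] {p a m s k : ℕ} (hp : p.Prime)
    (hG : Nat.card G = p ^ a * m) (hm : ¬ p ∣ m) (hV : Module.finrank K V = p ^ a * s)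
    {g : G} (hk : k ≠ 0) (hg : orderOf g = p ^ k) :
    LinearMap.trace K V (ρ g) = 0 := by
  have := Fintype.ofFinite G
  have := Fact.mk hp
  obtain ⟨R, hR⟩ := exists_valuationSubring_charP_residueField K p hp
  obtain ⟨n, B, A, hA⟩ := ρ.exists_matrix_valuationRing (R := R)
  have hinj : Function.Injective (algebraMap R K) := IsFractionRing.injective R K
  have htr (x : G) : LinearMap.trace K V (ρ x) = algebraMap R K (A x).trace := by
    rw [LinearMap.trace_eq_matrix_trace K B, AddMonoidHom.map_trace]
    exact congrArg Matrix.trace (hA x).symm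
  rw [htr, map_eq_zero_iff _ hinj]
  obtain hn | hn := isEmpty_or_nonempty (Fin n)
  · exact Matrix.trace_eq_zero_of_isEmpty _
  let v₀ : Matrix (Fin n) (Fin n) R := Matrix.single hn.some hn.some 1
  have hsum : (s : R) • ∑ x, A x * v₀ * A x⁻¹ = (m : R) • 1 := by
    have hp0 : ((p ^ a : ℕ) : R) ≠ 0 := by
      rw [← map_ne_zero_iff _ hinj, map_natCast]
      exact_mod_cast (pow_pos hp.pos a).ne'
    refine smul_right_injective _ hp0 ?_
    simp only [smul_smul, ← Nat.cast_mul]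
    rw [← hV, ← hG]
    have hL (x : G) : LinearMap.toMatrixAlgEquiv B (ρ x) = (algebraMap R K).mapMatrix (A x) :=
      (hA x).symm
    have h := congrArg (LinearMap.toMatrixAlgEquiv B) (ρ.finrank_smul_sum_conj
      ((LinearMap.toMatrixAlgEquiv B).symm ((algebraMap R K).mapMatrix v₀)))
    have htr₀ : LinearMap.trace K V ((LinearMap.toMatrixAlgEquiv B).symm
        ((algebraMap R K).mapMatrix v₀)) = 1 := by
      rw [LinearMap.trace_eq_matrix_trace K B]
      change (LinearMap.toMatrixAlgEquiv B ((LinearMap.toMatrixAlgEquiv B).symm _)).trace = 1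
      rw [AlgEquiv.apply_symm_apply, RingHom.mapMatrix_apply, ← AddMonoidHom.map_trace]
      simp [v₀, Matrix.trace_single_eq_same]
    simp only [htr₀, map_smul, map_sum, map_mul, hL, AlgEquiv.apply_symm_apply, mul_one, map_one,
      ← Nat.card_eq_fintype_card] at h
    refine Matrix.map_injective hinj ?_
    change (algebraMap R K).mapMatrix _ = (algebraMap R K).mapMatrix _
    rw [Nat.cast_smul_eq_nsmul, Nat.cast_smul_eq_nsmul] at h ⊢
    simp only [map_nsmul, map_sum, map_mul, map_one]
    exact h
  have hmu : IsUnit (m : R) := by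
    refine (isUnit_map_iff (IsLocalRing.residue R) _).1 ?_
    rw [map_natCast, isUnit_iff_ne_zero, Ne, CharP.cast_eq_zero_iff _ p]
    exact hm
  obtain ⟨μ, hμ⟩ := hmu
  obtain ⟨w, hw⟩ := A.exists_sum_range_conj_eq_sum_conj g (((μ⁻¹ : Rˣ) : R) • (s : R) • v₀)
  have hw1 : ∑ x, A x * (((μ⁻¹ : Rˣ) : R) • (s : R) • v₀) * A x⁻¹ = 1 := by
    simp only [mul_smul_comm, smul_mul_assoc, ← Finset.smul_sum]
    rw [hsum, ← hμ, smul_smul, Units.inv_mul, one_smul]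
  obtain ⟨z, hz⟩ := HasEnoughRootsOfUnity.exists_primitiveRoot K (p ^ k)
  obtain ⟨ζ, rfl⟩ := (IsIntegrallyClosed.isIntegral_iff (R := R)).1
    (hz.isIntegral (pow_pos hp.pos k)).tower_top
  have hζ : IsPrimitiveRoot ζ (p ^ k) := hz.of_map_of_injective hinj
  refine Matrix.trace_eq_zero_of_sum_conj_eq_one p k hk hζ (A.toHomUnits g) ?_ w ?_
  · rw [← map_pow, ← hg, pow_orderOf_eq_one, map_one]
  · rw [← hw1, ← hw, hg]
    refine Finset.sum_congr rfl fun i _ => ?_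
    rw [← map_pow, ← map_inv]
    rfl

theorem FDRep.isIrreducible_of_simple {k G : Type} [Field k] [Group G] (V : FDRep k G)
    [CategoryTheory.Simple V] : Representation.IsIrreducible V.ρ := by
  have hnt : Nontrivial V := by
    by_contra h
    rw [not_nontrivial_iff_subsingleton] at h
    refine CategoryTheory.id_nonzero V ?_
    ext v
    exact Subsingleton.elim _ _
  have : Nontrivial (Subrepresentation V.ρ) :=
    ⟨⊥, ⊤, fun h => bot_ne_top (congrArg Subrepresentation.toSubmodule h)⟩
  refine ⟨fun W => or_iff_not_imp_left.2 fun hW => ?_⟩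
  let f : FDRep.of W.toRepresentation ⟶ V :=
    ⟨CategoryTheory.InducedCategory.homMk (ModuleCat.ofHom W.toSubmodule.subtype), fun g => by
      ext; rfl⟩
  have hmono : CategoryTheory.Mono f := by
    refine (CategoryTheory.forget (FDRep k G)).mono_of_mono_map ?_
    rw [CategoryTheory.mono_iff_injective]
    exact W.toSubmodule.injective_subtype
  have hf : f ≠ 0 := by
    intro h
    refine hW (Subrepresentation.toSubmodule_injective ((Submodule.eq_bot_iff _).2 fun v hv => ?_))
    exact congrArg (fun F : FDRep.of W.toRepresentation ⟶ V => F.hom.hom.hom ⟨v, hv⟩) h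
  have hiso := CategoryTheory.isIso_of_mono_of_nonzero hf
  refine Subrepresentation.toSubmodule_injective (Submodule.eq_top_iff'.2 fun v => ?_)
  have h := congrArg (fun F : V ⟶ V => F.hom.hom.hom v) (CategoryTheory.IsIso.inv_hom_id f)
  have h' : (((CategoryTheory.inv f).hom.hom.hom v : W.toSubmodule) : V) = v := h
  rw [← h']
  exact Subtype.property _

theorem IsIrrChar.of_isIrreducible {G V : Type} [Group G] [Finite G] [AddCommGroup V] [Module ℂ V]
    [FiniteDimensional ℂ V] (ρ : Representation ℂ G V) [ρ.IsIrreducible] :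
    IsIrrChar G ρ.character := by
  have := Fintype.ofFinite G
  refine ⟨FDRep.of ρ, (FDRep.simple_iff_char_is_norm_one _).2 ?_, rfl⟩
  have : Invertible (Nat.card G : ℂ) := invertibleOfNonzero (NeZero.ne _)
  have h := Representation.char_orthonormal ρ ρ
  rw [if_pos ⟨Representation.Equiv.refl ρ⟩, inv_mul_eq_one₀ (NeZero.ne _)] at h
  exact h.symm

theorem Representation.character_eq_add_of_isCompl {k G V : Type*} [Field k] [Group G]
    [AddCommGroup V] [Module k V] [FiniteDimensional k V] (ρ : Representation k G V)
    {W W' : Subrepresentation ρ} (h : IsCompl W.toSubmodule W'.toSubmodule) :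
    ρ.character = W.toRepresentation.character + W'.toRepresentation.character := by
  ext g
  let e := Submodule.prodEquivOfIsCompl _ _ h
  have hconj : ρ g = e.conj ((W.toRepresentation g).prodMap (W'.toRepresentation g)) := by
    rw [LinearEquiv.conj_apply, LinearEquiv.eq_comp_toLinearMap_symm]
    ext v <;> simp [e, Subrepresentation.toRepresentation]
  change LinearMap.trace k V (ρ g) = _
  rw [hconj, LinearMap.trace_conj', LinearMap.trace_prodMap']
  rfl

theorem Representation.isVirtualChar_character {G V : Type} [Group G] [Finite G] [AddCommGroup V]
    [Module ℂ V] [FiniteDimensional ℂ V] (ρ : Representation ℂ G V) :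
    IsVirtualChar G ρ.character := by
  induction hn : Module.finrank ℂ V using Nat.strong_induction_on generalizing V with
  | _ n ih =>
  by_cases hirr : ρ.IsIrreducible
  · exact Submodule.subset_span (.of_isIrreducible ρ)
  obtain hV | hV := subsingleton_or_nontrivial V
  · have h0 : ρ.character = 0 := by
      ext g
      change LinearMap.trace ℂ V (ρ g) = 0
      rw [Subsingleton.elim (ρ g) 0, map_zero]
    rw [h0]
    exact Submodule.zero_mem _
  have hnt : Nontrivial (Subrepresentation ρ) :=
    ⟨⊥, ⊤, fun h => bot_ne_top (congrArg Subrepresentation.toSubmodule h)⟩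
  obtain ⟨W, hW⟩ : ∃ W : Subrepresentation ρ, ¬ (W = ⊥ ∨ W = ⊤) := by
    by_contra! h
    exact hirr ⟨h⟩
  rw [not_or] at hW
  have hss : ρ.IsSemisimpleRepresentation := by
    rw [Representation.isSemisimpleRepresentation_iff_isSemisimpleModule_asModule]
    infer_instance
  obtain ⟨W', hWW'⟩ := exists_isCompl W
  have hc : IsCompl W.toSubmodule W'.toSubmodule := by
    refine IsCompl.of_eq ?_ ?_
    · rw [← Subrepresentation.toSubmodule_inf, hWW'.inf_eq_bot]; rfl
    · rw [← Subrepresentation.toSubmodule_sup, hWW'.sup_eq_top]; rfl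
  have hW0 : 0 < Module.finrank ℂ W.toSubmodule := by
    rw [Nat.pos_iff_ne_zero, Ne, Submodule.finrank_eq_zero]
    exact fun h => hW.1 (Subrepresentation.toSubmodule_injective h)
  have hW1 : Module.finrank ℂ W.toSubmodule < Module.finrank ℂ V :=
    Submodule.finrank_lt fun h => hW.2 (Subrepresentation.toSubmodule_injective h)
  have hadd := Submodule.finrank_add_eq_of_isCompl hc
  rw [ρ.character_eq_add_of_isCompl hc]
  exact Submodule.add_mem _ (ih _ (by omega) _ rfl) (ih _ (by omega) _ rfl)

theorem Representation.character_ofMulAction {k G X : Type*} [Field k] [Group G] [MulAction G X]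
    [Finite X] (g : G) :
    (Representation.ofMulAction k G X).character g = Nat.card (MulAction.fixedBy X g) := by
  classical
  have := Fintype.ofFinite X
  change LinearMap.trace k _ _ = _
  rw [LinearMap.trace_eq_matrix_trace k (MonoidAlgebra.basis X k), Matrix.trace]
  simp [LinearMap.toMatrix_apply, MonoidAlgebra.basis, Finsupp.single_apply, Fintype.card_subtype]

theorem KnutsonIndex_dvd {G : Type} [Group G] {χ φ : G → ℂ} {n : ℕ} (hn : 0 < n)
    (hφ : IsVirtualChar G φ) (h : χ * φ = n • regChar G) : KnutsonIndex G χ ∣ n := by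
  let s := {n : ℕ | 0 < n ∧ ∃ φ : G → ℂ, IsVirtualChar G φ ∧ χ * φ = n • regChar G}
  obtain ⟨hK, ψ, hψ, hKψ⟩ : KnutsonIndex G χ ∈ s := Nat.sInf_mem ⟨n, hn, φ, hφ, h⟩
  by_contra hdvd
  have hmem : n % KnutsonIndex G χ ∈ s := by
    refine ⟨Nat.pos_of_ne_zero fun h0 => hdvd (Nat.dvd_of_mod_eq_zero h0),
      φ - (n / KnutsonIndex G χ) • ψ, Submodule.sub_mem _ hφ (nsmul_mem hψ _), ?_⟩
    rw [mul_sub, mul_smul_comm, h, hKψ, ← mul_smul, sub_eq_iff_eq_add, ← add_smul,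
      mul_comm, Nat.mod_add_div]
  exact (Nat.mod_lt n hK).not_ge (Nat.sInf_le hmem)

/-- If the `p`-adic valuation of the degree of an irreducible character
`χ` of a finite group `G` equals the `p`-adic valuation of `|G|`, then `p` does not
divide the Knutson index of `χ`. -/
theorem not_dvd_knutson_index_of_maximal_valuation {G : Type} [Group G] [Finite G]
    (χ : G → ℂ) (hχ : IsIrrChar G χ) (p r : ℕ) (hp : p.Prime) (hr : χ 1 = (r : ℂ))
    (hval : r.factorization p = (Nat.card G).factorization p) :
    ¬ p ∣ KnutsonIndex G χ := by
  obtain ⟨V, hV, rfl⟩ := hχ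
  have hirr := V.isIrreducible_of_simple
  have := Fact.mk hp
  have hrV : Module.finrank ℂ V = r := by
    rw [FDRep.char_one] at hr
    exact_mod_cast hr
  have hr0 : r ≠ 0 := by
    have : Nontrivial V := by
      by_contra h
      rw [not_nontrivial_iff_subsingleton] at h
      exact bot_ne_top (α := Subrepresentation V.ρ)
        (Subrepresentation.toSubmodule_injective (Subsingleton.elim _ _))
    rw [← hrV]
    exact Module.finrank_pos.ne'
  set a := (Nat.card G).factorization p with ha
  obtain ⟨s, hs⟩ : p ^ a ∣ r := hval ▸ Nat.ordProj_dvd r p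
  obtain ⟨m, hm⟩ : p ^ a ∣ Nat.card G := Nat.ordProj_dvd _ p
  have hpa : 0 < p ^ a := pow_pos hp.pos a
  have hps : ¬ p ∣ s := by
    have h := Nat.not_dvd_ordCompl hp hr0
    rwa [hval, hs, Nat.mul_div_cancel_left _ hpa] at h
  have hpm : ¬ p ∣ m := by
    have h := Nat.not_dvd_ordCompl hp (Nat.card_pos (α := G)).ne'
    rwa [← ha, hm, Nat.mul_div_cancel_left _ hpa] at h
  have hs0 : 0 < s := Nat.pos_of_ne_zero fun h => hps (h ▸ dvd_zero p)
  obtain ⟨P⟩ : Nonempty (Sylow p G) := inferInstance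
  have hindex : Nat.card (G ⧸ (P : Subgroup G)) = m := by
    have h := (P : Subgroup G).card_mul_index
    rw [P.card_eq_multiplicity, ← ha, hm] at h
    exact Nat.eq_of_mul_eq_mul_left hpa h
  refine fun hdvd => hps (hdvd.trans (KnutsonIndex_dvd hs0
    (Representation.ofMulAction ℂ G (G ⧸ (P : Subgroup G))).isVirtualChar_character ?_))
  ext g
  rw [Pi.mul_apply, Pi.smul_apply, Representation.character_ofMulAction, regChar]
  obtain rfl | hg := eq_or_ne g 1
  · rw [hr, if_pos rfl, MulAction.fixedBy_one_eq_univ, Nat.card_univ, hindex, hs, hm,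
      nsmul_eq_mul]
    push_cast
    ring
  rw [if_neg hg, smul_zero, mul_eq_zero]
  obtain hempty | ⟨⟨x, hx⟩⟩ := isEmpty_or_nonempty (MulAction.fixedBy (G ⧸ (P : Subgroup G)) g)
  · right
    simp
  left
  obtain ⟨t, rfl⟩ := QuotientGroup.mk_surjective x
  have hgt : t⁻¹ * g * t ∈ (P : Subgroup G) := by
    have h : ((g * t : G) : G ⧸ (P : Subgroup G)) = t := hx
    rw [mul_assoc]
    exact QuotientGroup.eq.1 h.symm
  obtain ⟨k, hk⟩ := IsPGroup.iff_orderOf.1 P.isPGroup' ⟨_, hgt⟩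
  have hgk : orderOf g = p ^ k := by
    rw [← hk, Subgroup.orderOf_mk]
    simpa using (orderOf_injective (MulAut.conj t⁻¹).toMonoidHom (MulEquiv.injective _) g).symm
  refine Representation.trace_eq_zero_of_orderOf_eq_prime_pow V.ρ hp hm hpm (hrV.trans hs) ?_ hgk
  rintro rfl
  exact hg (orderOf_eq_one_iff.1 (by simpa using hgk))
end
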